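/- arXiv:1207.1994 — 3 statements merged into one kernel-verified Lean document; each statement's English description precedes it below -/
import Mathlib

section
/- Let g be a finite-dimensional Lie algebra over a field K of characteristic 0, E = g × g* with the symmetric pairing ⟨(X,α),(Y,β)⟩ = α(Y) + β(X) and the Dorfman bracket [(X,α),(Y,β)] = ([X,Y], Z ↦ α([Y,Z]) − β([X,Z])). Let ϖ be a symplectic form on g (a closed 2-form with ϖ♭ : g → g* bijective) and N : g → g linear. Then (ϖ,N) is a Hitchin pair (i.e., ϖ(NX,Y) = ϖ(X,NY) for all X,Y and the 2-form ϖ_N, ϖ_N(X,Y) = ϖ(NX,Y), is closed) if and only if (J_ϖ, J_N) is a compatible pair on E, i.e., J_ϖ∘J_N = −J_N∘J_ϖ and [u,v]_{J_ϖ,J_N} + [u,v]_{J_N,J_ϖ} = 0 for all u,v ∈ E. -/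
open Module

set_option linter.unusedSectionVars false

variable {K : Type*} [Field K] [CharZero K]
variable {g : Type*} [LieRing g] [LieAlgebra K g] [FiniteDimensional K g]

/-- The adjoint action of `x` as a linear map `z ↦ ⁅x, z⁆`. -/
def adl (x : g) : g →ₗ[K] g where
  toFun z := ⁅x, z⁆
  map_add' a b := lie_add x a b
  map_smul' c a := lie_smul c x a

@[simp] lemma adl_apply (x z : g) : adl (K := K) x z = ⁅x, z⁆ := rfl

/-- The Dorfman bracket on `g × g*`:
`[(X,α),(Y,β)] = (⁅X,Y⁆, Z ↦ α ⁅Y,Z⁆ - β ⁅X,Z⁆)`. -/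
def dorf (u v : g × Dual K g) : g × Dual K g :=
  (⁅u.1, v.1⁆, u.2 ∘ₗ adl (K := K) v.1 - v.2 ∘ₗ adl (K := K) u.1)

/-- Torsion of an endomorphism of `g × g*` with respect to the Dorfman bracket:
`T_I(u,v) = [Iu,Iv] - I([Iu,v] + [u,Iv] - I[u,v])`. -/
def torD (I : (g × Dual K g) →ₗ[K] (g × Dual K g)) (u v : g × Dual K g) :
    g × Dual K g :=
  dorf (I u) (I v) - I (dorf (I u) v + dorf u (I v) - I (dorf u v))

/-- `J_N (X, α) = (N X, -α ∘ N)`. -/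
def JN (N : g →ₗ[K] g) : (g × Dual K g) →ₗ[K] (g × Dual K g) :=
  LinearMap.prodMap N (-N.dualMap)

/-- `J_ω (X, α) = (0, ω♭ X)`. -/
def Jom (ω : g →ₗ[K] g →ₗ[K] K) : (g × Dual K g) →ₗ[K] (g × Dual K g) :=
  LinearMap.prod 0 (ω ∘ₗ LinearMap.fst K g (Dual K g))

/-- `J_π (X, α) = (π α, 0)`. -/
def Jpi (π : Dual K g →ₗ[K] g) : (g × Dual K g) →ₗ[K] (g × Dual K g) :=
  LinearMap.prod (π ∘ₗ LinearMap.snd K g (Dual K g)) 0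

/-- Deformation of a bracket on `g × g*` by an endomorphism. -/
def deformE (b : (g × Dual K g) → (g × Dual K g) → (g × Dual K g))
    (I : (g × Dual K g) →ₗ[K] (g × Dual K g)) :
    (g × Dual K g) → (g × Dual K g) → (g × Dual K g) :=
  fun u v => b (I u) v + b u (I v) - I (b u v)

/-- The Koszul bracket on `g*` associated to a bivector `θ`:
`[α,β]_θ = (Z ↦ α ⁅θβ, Z⁆ - β ⁅θα, Z⁆)`. -/
def koszul (θ : Dual K g →ₗ[K] g) (α β : Dual K g) : Dual K g :=
  α ∘ₗ adl (K := K) (θ β) - β ∘ₗ adl (K := K) (θ α)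

lemma Jom_apply (ϖ : g →ₗ[K] g →ₗ[K] K) (u : g × Dual K g) : Jom ϖ u = (0, ϖ u.1) := rfl

lemma JN_apply (N : g →ₗ[K] g) (u : g × Dual K g) : JN N u = (N u.1, -(u.2 ∘ₗ N)) := rfl

/-- The Dorfman bracket deformed by `J_ϖ` vanishes when `ϖ` is a closed 2-form. -/
lemma deformE_dorf_Jom_eq_zero {ϖ : g →ₗ[K] g →ₗ[K] K} (hAlt : ϖ.IsAlt)
    (hcl : ∀ X Y Z : g, ϖ ⁅X, Y⁆ Z + ϖ ⁅Y, Z⁆ X + ϖ ⁅Z, X⁆ Y = 0)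
    (u v : g × Dual K g) : deformE dorf (Jom ϖ) u v = 0 := by
  obtain ⟨X, α⟩ := u
  obtain ⟨Y, β⟩ := v
  refine Prod.ext (by simp [deformE, dorf, Jom]) (LinearMap.ext fun Z => ?_)
  have hXZ : ϖ ⁅Z, X⁆ Y = -ϖ ⁅X, Z⁆ Y := by
    rw [← lie_skew Z X, map_neg, LinearMap.neg_apply]
  simp only [deformE, dorf, Jom_apply, Prod.snd_sub, Prod.snd_add, Prod.snd_zero,
    LinearMap.coe_comp, Function.comp_apply, LinearMap.sub_apply, LinearMap.add_apply,
    LinearMap.zero_apply, adl_apply, zero_lie, map_zero]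
  linear_combination -hcl X Y Z + hXZ - hAlt.neg X ⁅Y, Z⁆ + hAlt.neg Y ⁅X, Z⁆

/-- If `ϖ` is a closed 2-form and `ϖ(NX, Y) = ϖ(X, NY)`, deforming the Dorfman bracket by `J_N`
and then by `J_ϖ` yields twice the differential of `ϖ_N`. -/
lemma deformE_deformE_dorf_JN_Jom_snd {ϖ : g →ₗ[K] g →ₗ[K] K} (hAlt : ϖ.IsAlt)
    (hcl : ∀ X Y Z : g, ϖ ⁅X, Y⁆ Z + ϖ ⁅Y, Z⁆ X + ϖ ⁅Z, X⁆ Y = 0)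
    {N : g →ₗ[K] g} (hN : ∀ X Y : g, ϖ (N X) Y = ϖ X (N Y)) (u v : g × Dual K g) (Z : g) :
    (deformE (deformE dorf (JN N)) (Jom ϖ) u v).2 Z =
      2 * (ϖ (N ⁅u.1, v.1⁆) Z + ϖ (N ⁅v.1, Z⁆) u.1 + ϖ (N ⁅Z, u.1⁆) v.1) := by
  obtain ⟨X, α⟩ := u
  obtain ⟨Y, β⟩ := v
  have hskew (A B : g) : ϖ ⁅A, B⁆ Y = -ϖ ⁅B, A⁆ Y := by
    rw [← lie_skew A B, map_neg, LinearMap.neg_apply]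
  have hNskew : ϖ (N ⁅Z, X⁆) Y = -ϖ (N ⁅X, Z⁆) Y := by
    rw [← lie_skew Z X, map_neg, map_neg, LinearMap.neg_apply]
  simp only [deformE, dorf, Jom_apply, JN_apply, Prod.snd_sub, Prod.snd_add,
    LinearMap.coe_comp, Function.comp_apply, LinearMap.sub_apply, LinearMap.add_apply,
    LinearMap.neg_apply, adl_apply, zero_lie, lie_zero, map_zero, map_sub, map_add]
  linear_combination -hcl X Y (N Z) - hcl X (N Y) Z - hcl (N X) Y Z
    - hAlt.neg X ⁅N Y, Z⁆ - hAlt.neg X ⁅Y, N Z⁆ + hAlt.neg Y ⁅N X, Z⁆ + hAlt.neg Y ⁅X, N Z⁆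
    + hskew Z (N X) + hskew (N Z) X + hAlt.neg X (N ⁅Y, Z⁆) - hAlt.neg Y (N ⁅X, Z⁆) - hNskew
    - hN ⁅X, Y⁆ Z - hN ⁅Y, Z⁆ X - hN ⁅Z, X⁆ Y

/-- The first component of the Dorfman bracket deformed by `J_N` and then by `J_ϖ` vanishes. -/
lemma deformE_deformE_dorf_JN_Jom_fst (ϖ : g →ₗ[K] g →ₗ[K] K) (N : g →ₗ[K] g)
    (u v : g × Dual K g) : (deformE (deformE dorf (JN N)) (Jom ϖ) u v).1 = 0 := by
  simp [deformE, dorf, Jom, JN]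

/-- `J_ϖ` and `J_N` anticommute iff `N` is self-adjoint for `ϖ`. -/
lemma Jom_comp_JN_eq_neg_iff (ϖ : g →ₗ[K] g →ₗ[K] K) (N : g →ₗ[K] g) :
    Jom ϖ ∘ₗ JN N = -(JN N ∘ₗ Jom ϖ) ↔ ∀ X Y : g, ϖ (N X) Y = ϖ X (N Y) := by
  constructor
  · intro h X Y
    simpa [Jom, JN] using DFunLike.congr_fun (congrArg Prod.snd (LinearMap.congr_fun h (X, 0))) Y
  · intro h
    refine LinearMap.ext fun u => Prod.ext (by simp [Jom, JN]) (LinearMap.ext fun Y => ?_)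
    simpa [Jom, JN] using h u.1 Y

/-- For a symplectic form `ϖ` and a `(1,1)`-tensor `N` on `g`, the pair `(ϖ, N)`
is a Hitchin pair iff `(J_ϖ, J_N)` is a compatible pair on `g × g*`. -/
theorem hitchin_iff_compatible_pair (ϖ : g →ₗ[K] g →ₗ[K] K) (hAlt : ∀ X, ϖ X X = 0)
    (hcl : ∀ X Y Z : g, ϖ ⁅X, Y⁆ Z + ϖ ⁅Y, Z⁆ X + ϖ ⁅Z, X⁆ Y = 0)
    (hbij : Function.Bijective fun X : g => (ϖ X : Dual K g))
    (N : g →ₗ[K] g) :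
    ((∀ X Y : g, ϖ (N X) Y = ϖ X (N Y)) ∧
      (∀ X Y Z : g, ϖ (N ⁅X, Y⁆) Z + ϖ (N ⁅Y, Z⁆) X + ϖ (N ⁅Z, X⁆) Y = 0)) ↔
      (Jom ϖ ∘ₗ JN N = -(JN N ∘ₗ Jom ϖ) ∧
        ∀ u v : g × Dual K g,
          deformE (deformE dorf (Jom ϖ)) (JN N) u v
            + deformE (deformE dorf (JN N)) (Jom ϖ) u v = 0) := by
  rw [Jom_comp_JN_eq_neg_iff]
  refine and_congr_right fun hN => ?_
  have hzero : deformE dorf (Jom ϖ) = fun _ _ => 0 :=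
    funext₂ (deformE_dorf_Jom_eq_zero hAlt hcl)
  have hdef (u v : g × Dual K g) : deformE (deformE dorf (Jom ϖ)) (JN N) u v = 0 := by
    rw [hzero]
    simp [deformE]
  simp only [hdef, zero_add]
  constructor
  · intro h u v
    refine Prod.ext (deformE_deformE_dorf_JN_Jom_fst ϖ N u v) (LinearMap.ext fun Z => ?_)
    rw [deformE_deformE_dorf_JN_Jom_snd hAlt hcl hN, h, mul_zero]
    rfl
  · intro h X Y Z
    have h2 := deformE_deformE_dorf_JN_Jom_snd hAlt hcl hN (X, 0) (Y, 0) Z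
    rw [h] at h2
    exact (mul_eq_zero.mp h2.symm).resolve_left two_ne_zero
end

section
/- Let g be a finite-dimensional Lie algebra over a field K of characteristic 0, E = g × g* with the Dorfman bracket [(X,α),(Y,β)] = ([X,Y], Z ↦ α([Y,Z]) − β([X,Z])). Let π : g* → g be a bivector and N : g → g linear with N∘N = λ·id_g for some λ ∈ K. Then (π,N) is a Poisson–Nijenhuis structure on g if and only if the endomorphism J_π + J_N of E has vanishing torsion with respect to the Dorfman bracket and J_π∘J_N + J_N∘J_π = 0. -/
open Module

set_option linter.unusedSectionVars false

variable {K : Type*} [Field K] [CharZero K]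
variable {g : Type*} [LieRing g] [LieAlgebra K g] [FiniteDimensional K g]

/-- The Nijenhuis torsion of `N` on `g`. -/
def nijenhuisTorsion (N : g →ₗ[K] g) (X Y : g) : g :=
  ⁅N X, N Y⁆ - N ⁅N X, Y⁆ - N ⁅X, N Y⁆ + N (N ⁅X, Y⁆)

/-- The cyclic sum whose vanishing says that `π` is Poisson. -/
def jacobiator (π : Dual K g →ₗ[K] g) (α β γ : Dual K g) : K :=
  α ⁅π β, π γ⁆ + β ⁅π γ, π α⁆ + γ ⁅π α, π β⁆

/-- The concomitant of `π` and `N`, in the form it takes when `N ∘ π = π ∘ N*`. -/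
def concomitant (π : Dual K g →ₗ[K] g) (N : g →ₗ[K] g) (α β : Dual K g) (Z : g) : K :=
  α (N ⁅π β, Z⁆) - β (N ⁅π α, Z⁆) - α ⁅π β, N Z⁆ + β ⁅π α, N Z⁆

lemma koszul_apply (θ : Dual K g →ₗ[K] g) (α β : Dual K g) (Z : g) :
    koszul θ α β Z = α ⁅θ β, Z⁆ - β ⁅θ α, Z⁆ := rfl

lemma koszul_compatible_iff (π : Dual K g →ₗ[K] g) (N : g →ₗ[K] g)
    (hcomm : ∀ α : Dual K g, N (π α) = π (N.dualMap α)) (α β : Dual K g) :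
    koszul (N ∘ₗ π) α β =
        koszul π (N.dualMap α) β + koszul π α (N.dualMap β) - N.dualMap (koszul π α β) ↔
      ∀ Z, concomitant π N α β Z = 0 := by
  rw [LinearMap.ext_iff]
  refine forall_congr' fun Z => ?_
  simp only [LinearMap.sub_apply, LinearMap.add_apply, koszul_apply, LinearMap.comp_apply,
    LinearMap.dualMap_apply, ← hcomm, concomitant]
  constructor <;> intro h <;> linear_combination -h

lemma anticomm_iff (π : Dual K g →ₗ[K] g) (N : g →ₗ[K] g) :
    Jpi π ∘ₗ JN N + JN N ∘ₗ Jpi π = 0 ↔ ∀ α : Dual K g, N (π α) = π (N.dualMap α) := by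
  have key : ∀ u : g × Dual K g, (Jpi π ∘ₗ JN N + JN N ∘ₗ Jpi π) u =
      (N (π u.2) - π (N.dualMap u.2), 0) := fun u => by
    ext <;> simp [Jpi, JN, sub_eq_neg_add]
  constructor
  · intro h α
    have := congrArg Prod.fst (key (0, α))
    rw [h] at this
    exact sub_eq_zero.mp this.symm
  · intro h
    refine LinearMap.ext fun u => ?_
    rw [key, h, sub_self]
    rfl

lemma apply_torD_fst (π : Dual K g →ₗ[K] g)
    (hskew : ∀ α β : Dual K g, α (π β) = -β (π α)) (N : g →ₗ[K] g)
    (hcomm : ∀ α : Dual K g, N (π α) = π (N.dualMap α)) (X Y : g) (α β γ : Dual K g) :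
    γ (torD (Jpi π + JN N) (X, α) (Y, β)).1 =
      jacobiator π α β γ + γ (nijenhuisTorsion N X Y) +
        concomitant π N γ β X - concomitant π N γ α Y := by
  have hI : ∀ u : g × Dual K g, (Jpi π + JN N) u = (π u.2 + N u.1, -N.dualMap u.2) :=
    fun u => by ext <;> simp [Jpi, JN]
  simp only [torD, dorf, hI, Prod.fst_sub, Prod.snd_sub, Prod.fst_add, Prod.snd_add, map_sub γ,
    map_add γ, hskew γ]
  simp only [jacobiator, nijenhuisTorsion, concomitant, map_sub, map_add, hcomm, lie_add, add_lie,
    LinearMap.sub_apply, LinearMap.add_apply, LinearMap.neg_apply, LinearMap.comp_apply,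
    adl_apply, LinearMap.dualMap_apply, hskew γ (N.dualMap _)]
  simp only [← hcomm, ← lie_skew (π γ) (π α), ← lie_skew (π _) X, ← lie_skew (π _) Y,
    ← lie_skew (π _) (N _), map_neg]
  ring

lemma torD_snd_apply (π : Dual K g →ₗ[K] g) (N : g →ₗ[K] g) (lam : K)
    (hN2 : N ∘ₗ N = lam • (LinearMap.id : g →ₗ[K] g)) (X Y Z : g) (α β : Dual K g) :
    (torD (Jpi π + JN N) (X, α) (Y, β)).2 Z =
      α (nijenhuisTorsion N Y Z) - β (nijenhuisTorsion N X Z) - concomitant π N α β Z := by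
  have hI : ∀ u : g × Dual K g, (Jpi π + JN N) u = (π u.2 + N u.1, -N.dualMap u.2) :=
    fun u => by ext <;> simp [Jpi, JN]
  have hN : ∀ W, N (N W) = lam • W := fun W => LinearMap.congr_fun hN2 W
  simp only [torD, dorf, hI, Prod.snd_sub, Prod.fst_add, Prod.fst_sub, Prod.snd_add,
    nijenhuisTorsion, concomitant, map_sub, map_add, lie_add, add_lie, LinearMap.sub_apply,
    LinearMap.add_apply, LinearMap.neg_apply, LinearMap.comp_apply, adl_apply,
    LinearMap.dualMap_apply, map_neg, hN, map_smul]
  ring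

/-- For a bivector `π` and `N` with `N² = λ id`, the pair `(π, N)` is a
Poisson–Nijenhuis structure on `g` iff `J_π + J_N` has vanishing torsion on
`g × g*` and `J_π` and `J_N` anti-commute. -/
theorem pn_iff_torD (π : Dual K g →ₗ[K] g)
    (hskew : ∀ α β : Dual K g, α (π β) = -β (π α))
    (N : g →ₗ[K] g) (lam : K)
    (hN2 : N ∘ₗ N = lam • (LinearMap.id : g →ₗ[K] g)) :
    ((∀ α β γ : Dual K g, α ⁅π β, π γ⁆ + β ⁅π γ, π α⁆ + γ ⁅π α, π β⁆ = 0) ∧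
      (∀ X Y : g, ⁅N X, N Y⁆ - N ⁅N X, Y⁆ - N ⁅X, N Y⁆ + N (N ⁅X, Y⁆) = 0) ∧
      (∀ α : Dual K g, N (π α) = π (N.dualMap α)) ∧
      (∀ α β : Dual K g,
        koszul (N ∘ₗ π) α β =
          koszul π (N.dualMap α) β + koszul π α (N.dualMap β)
            - N.dualMap (koszul π α β))) ↔
      ((∀ u v : g × Dual K g, torD (Jpi π + JN N) u v = 0) ∧
        Jpi π ∘ₗ JN N + JN N ∘ₗ Jpi π = 0) := by
  rw [anticomm_iff]
  constructor
  · rintro ⟨hP, hN, hcomm, hK⟩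
    have hC : ∀ α β Z, concomitant π N α β Z = 0 := fun α β =>
      (koszul_compatible_iff π N hcomm α β).mp (hK α β)
    refine ⟨?_, hcomm⟩
    rintro ⟨X, α⟩ ⟨Y, β⟩
    refine Prod.ext ?_ (LinearMap.ext fun Z => ?_)
    · refine (Module.forall_dual_apply_eq_zero_iff K _).mp fun γ => ?_
      simp [apply_torD_fst π hskew N hcomm, hC, jacobiator, hP, nijenhuisTorsion, hN]
    · simp only [torD_snd_apply π N lam hN2, hC, nijenhuisTorsion, hN]
      simp
  · rintro ⟨hT, hcomm⟩
    have hfst := apply_torD_fst π hskew N hcomm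
    have hsnd := torD_snd_apply π N lam hN2
    simp only [hT] at hfst hsnd
    refine ⟨fun α β γ => ?_, fun X Y => ?_, hcomm, fun α β => ?_⟩
    · simpa [nijenhuisTorsion, concomitant, jacobiator] using (hfst 0 0 α β γ).symm
    · refine (Module.forall_dual_apply_eq_zero_iff K _).mp fun γ => ?_
      simpa [nijenhuisTorsion, concomitant, jacobiator] using (hfst X Y 0 0 γ).symm
    · refine (koszul_compatible_iff π N hcomm α β).mpr fun Z => ?_
      simpa [nijenhuisTorsion] using (hsnd 0 0 Z α β).symm
end

section
/- Let g be a finite-dimensional Lie algebra over a field K of characteristic 0 and (ω,N) an ΩN structure on g. Define the deformed brackets μ_{N^[0]}(X,Y) := [X,Y] and μ_{N^[k+1]}(X,Y) := μ_{N^[k]}(NX,Y) + μ_{N^[k]}(X,NY) − N(μ_{N^[k]}(X,Y)). Then for all m,n,k ∈ ℕ the pair (ω_{N^n}, N^m) is an ΩN structure on g with respect to the bracket μ_{N^[k]}; explicitly: (i) ω_{N^n} is closed with respect to μ_{N^[k]}; (ii) N^m is Nijenhuis with respect to μ_{N^[k]}, i.e., μ_{N^[k]}(N^m X, N^m Y)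 − N^m(μ_{N^[k]}(N^m X,Y)) − N^m(μ_{N^[k]}(X, N^m Y)) + N^{2m}(μ_{N^[k]}(X,Y)) = 0 for all X,Y; (iii) ω_{N^n}(N^m X, Y) = ω_{N^n}(X, N^m Y) for all X,Y; and (iv) ω_{N^{n+m}} = (ω_{N^n})_{N^m} is closed with respect to μ_{N^[k]}. -/
set_option linter.unusedSectionVars false

variable {K : Type*} [Field K] [CharZero K]
variable {g : Type*} [LieRing g] [LieAlgebra K g] [FiniteDimensional K g]

/-- The `k`-fold deformation `μ_{N^[k]}` of the Lie bracket of `g` by `N`. -/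
def mubr (N : g →ₗ[K] g) : ℕ → g → g → g
  | 0, X, Y => ⁅X, Y⁆
  | k + 1, X, Y => mubr N k (N X) Y + mubr N k X (N Y) - N (mubr N k X Y)

lemma nijenhuis_one_pow (N : g →ₗ[K] g) (B : g → g → g)
    (h : ∀ X Y, B (N X) (N Y) - N (B (N X) Y) - N (B X (N Y)) + N (N (B X Y)) = 0) (b : ℕ) :
    ∀ X Y, B (N X) ((N ^ b) Y) - N (B X ((N ^ b) Y)) - (N ^ b) (B (N X) Y)
      + (N ^ b) (N (B X Y)) = 0 := by
  induction b with
  | zero => intro X Y; simp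
  | succ b ih =>
    intro X Y
    have h₁ := ih X (N Y)
    have h₂ := congrArg (N ^ b) (h X Y)
    simp only [map_add, map_sub, map_zero] at h₂
    simp only [pow_succ, Module.End.mul_apply]
    linear_combination (norm := module) h₁ + h₂

lemma nijenhuis_pow_pow (N : g →ₗ[K] g) (B : g → g → g)
    (h : ∀ X Y, B (N X) (N Y) - N (B (N X) Y) - N (B X (N Y)) + N (N (B X Y)) = 0) (a b : ℕ) :
    ∀ X Y, B ((N ^ a) X) ((N ^ b) Y) - (N ^ a) (B X ((N ^ b) Y)) - (N ^ b) (B ((N ^ a) X) Y)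
      + (N ^ (a + b)) (B X Y) = 0 := by
  induction a with
  | zero => intro X Y; simp
  | succ a ih =>
    intro X Y
    have h₁ := nijenhuis_one_pow N B h b ((N ^ a) X) Y
    have h₂ := congrArg N (ih X Y)
    simp only [map_add, map_sub, map_zero] at h₂
    have e (Z : g) : N ((N ^ b) Z) = (N ^ b) (N Z) := by
      rw [← Module.End.mul_apply, ← Module.End.mul_apply, ← pow_succ, ← pow_succ']
    rw [e] at h₂
    rw [add_right_comm a 1 b]
    simp only [pow_succ', Module.End.mul_apply]
    linear_combination (norm := module) h₁ + h₂

lemma nijenhuis_mubr (N : g →ₗ[K] g)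
    (h : ∀ X Y : g, ⁅N X, N Y⁆ - N ⁅N X, Y⁆ - N ⁅X, N Y⁆ + N (N ⁅X, Y⁆) = 0) (k : ℕ) :
    ∀ X Y, mubr N k (N X) (N Y) - N (mubr N k (N X) Y) - N (mubr N k X (N Y))
      + N (N (mubr N k X Y)) = 0 := by
  induction k with
  | zero => exact h
  | succ k ih =>
    intro X Y
    have h₁ := ih (N X) Y
    have h₂ := ih X (N Y)
    have h₃ := congrArg N (ih X Y)
    simp only [map_add, map_sub, map_zero] at h₃
    simp only [mubr, map_add, map_sub]
    linear_combination (norm := module) h₁ + h₂ - h₃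

lemma apply_pow_apply (ω : g →ₗ[K] g →ₗ[K] K) (N : g →ₗ[K] g)
    (hsym : ∀ X Y : g, ω (N X) Y = ω X (N Y)) (n : ℕ) (X Y : g) :
    ω ((N ^ n) X) (N Y) = ω ((N ^ (n + 1)) X) Y := by
  rw [pow_succ', Module.End.mul_apply, hsym]

lemma closed_pow (ω : g →ₗ[K] g →ₗ[K] K) (N : g →ₗ[K] g)
    (hsym : ∀ X Y : g, ω (N X) Y = ω X (N Y)) (B : g → g → g)
    (h : ∀ X Y, B (N X) (N Y) - N (B (N X) Y) - N (B X (N Y)) + N (N (B X Y)) = 0)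
    (h₀ : ∀ X Y Z, ω (B X Y) Z + ω (B Y Z) X + ω (B Z X) Y = 0)
    (h₁ : ∀ X Y Z, ω (N (B X Y)) Z + ω (N (B Y Z)) X + ω (N (B Z X)) Y = 0) (n : ℕ) :
    ∀ X Y Z, ω ((N ^ n) (B X Y)) Z + ω ((N ^ n) (B Y Z)) X + ω ((N ^ n) (B Z X)) Y = 0 := by
  induction n using Nat.twoStepInduction with
  | zero => simpa using h₀
  | one => simpa using h₁
  | more n c₀ c₁ =>
    intro X Y Z
    have hN (U V W : g) : ω ((N ^ n) (B (N U) (N V))) W - ω ((N ^ (n + 1)) (B (N U) V)) W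
        - ω ((N ^ (n + 1)) (B U (N V))) W + ω ((N ^ (n + 2)) (B U V)) W = 0 := by
      have := congrArg (fun T => ω ((N ^ n) T) W) (h U V)
      simpa [pow_succ] using this
    have a₁ := c₀ (N X) (N Y) Z
    have a₂ := c₀ X (N Y) (N Z)
    have a₃ := c₀ (N X) Y (N Z)
    have b₁ := c₁ (N X) Y Z
    have b₂ := c₁ X (N Y) Z
    have b₃ := c₁ X Y (N Z)
    simp only [apply_pow_apply ω N hsym] at a₁ a₂ a₃ b₁ b₂ b₃
    have three : (3 : K) ≠ 0 := by norm_num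
    refine (mul_eq_zero.mp ?_).resolve_left three
    linear_combination hN X Y Z + hN Y Z X + hN Z X Y - a₁ - a₂ - a₃ + 2 * (b₁ + b₂ + b₃)

lemma closed_pow_mubr (ω : g →ₗ[K] g →ₗ[K] K) (N : g →ₗ[K] g)
    (hsym : ∀ X Y : g, ω (N X) Y = ω X (N Y))
    (h : ∀ n : ℕ, ∀ X Y Z : g,
      ω ((N ^ n) ⁅X, Y⁆) Z + ω ((N ^ n) ⁅Y, Z⁆) X + ω ((N ^ n) ⁅Z, X⁆) Y = 0) (k : ℕ) :
    ∀ (n : ℕ) (X Y Z : g), ω ((N ^ n) (mubr N k X Y)) Z + ω ((N ^ n) (mubr N k Y Z)) X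
      + ω ((N ^ n) (mubr N k Z X)) Y = 0 := by
  induction k with
  | zero => exact h
  | succ k ih =>
    intro n X Y Z
    have a₁ := ih n (N X) Y Z
    have a₂ := ih n X (N Y) Z
    have a₃ := ih n X Y (N Z)
    have b := ih (n + 1) X Y Z
    simp only [apply_pow_apply ω N hsym] at a₁ a₂ a₃
    have e (T : g) : (N ^ n) (N T) = (N ^ (n + 1)) T := by rw [pow_succ, Module.End.mul_apply]
    simp only [mubr, map_add, map_sub, LinearMap.add_apply, LinearMap.sub_apply, e]
    linear_combination a₁ + a₂ + a₃ - 2 * b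

/-- Hierarchy of ΩN structures: if `(ω, N)` is an ΩN structure on `g`, then
for all `m, n, k` the pair `(ω_{N^n}, N^m)` is an ΩN structure with respect to
the deformed bracket `μ_{N^[k]}`. -/
theorem omegaN_hierarchy (ω : g →ₗ[K] g →ₗ[K] K)
    (hAlt : ∀ X, ω X X = 0)
    (hcl : ∀ X Y Z : g, ω ⁅X, Y⁆ Z + ω ⁅Y, Z⁆ X + ω ⁅Z, X⁆ Y = 0)
    (N : g →ₗ[K] g)
    (hNij : ∀ X Y : g, ⁅N X, N Y⁆ - N ⁅N X, Y⁆ - N ⁅X, N Y⁆ + N (N ⁅X, Y⁆) = 0)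
    (hsym : ∀ X Y : g, ω (N X) Y = ω X (N Y))
    (hclN : ∀ X Y Z : g, ω (N ⁅X, Y⁆) Z + ω (N ⁅Y, Z⁆) X + ω (N ⁅Z, X⁆) Y = 0) :
    ∀ m n k : ℕ,
      -- (i) `ω_{N^n}` is closed with respect to `μ_{N^[k]}`
      (∀ X Y Z : g,
        ω ((N ^ n) (mubr N k X Y)) Z + ω ((N ^ n) (mubr N k Y Z)) X
          + ω ((N ^ n) (mubr N k Z X)) Y = 0) ∧
      -- (ii) `N^m` is Nijenhuis with respect to `μ_{N^[k]}`
      (∀ X Y : g,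
        mubr N k ((N ^ m) X) ((N ^ m) Y)
          - (N ^ m) (mubr N k ((N ^ m) X) Y)
          - (N ^ m) (mubr N k X ((N ^ m) Y))
          + (N ^ (2 * m)) (mubr N k X Y) = 0) ∧
      -- (iii) `ω_{N^n}(N^m X, Y) = ω_{N^n}(X, N^m Y)`
      (∀ X Y : g, ω ((N ^ n) ((N ^ m) X)) Y = ω ((N ^ n) X) ((N ^ m) Y)) ∧
      -- (iv) `ω_{N^{n+m}} = (ω_{N^n})_{N^m}` is closed w.r.t. `μ_{N^[k]}`
      (∀ X Y : g, ω ((N ^ (n + m)) X) Y = ω ((N ^ n) ((N ^ m) X)) Y) ∧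
      (∀ X Y Z : g,
        ω ((N ^ (n + m)) (mubr N k X Y)) Z + ω ((N ^ (n + m)) (mubr N k Y Z)) X
          + ω ((N ^ (n + m)) (mubr N k Z X)) Y = 0) := by
  intro m n k
  have hc := closed_pow_mubr ω N hsym
    (closed_pow ω N hsym (fun X Y => ⁅X, Y⁆) hNij hcl hclN) k
  refine ⟨hc n, fun X Y => ?_, fun X Y => ?_, fun X Y => ?_, hc (n + m)⟩
  · have := nijenhuis_pow_pow N (mubr N k) (nijenhuis_mubr N hNij k) m m X Y
    rw [two_mul]
    linear_combination (norm := module) this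
  · induction m generalizing Y with
    | zero => simp
    | succ m ih =>
      have e : (N ^ n) ((N ^ (m + 1)) X) = N ((N ^ n) ((N ^ m) X)) := by
        simp only [← Module.End.mul_apply, ← pow_add, ← pow_succ', add_assoc]
      rw [e, hsym, ih, pow_succ, Module.End.mul_apply]
  · rw [pow_add, Module.End.mul_apply]
end
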